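/- Let X be a locally complete intersection variety over an algebraically closed field. If the m-th jet scheme X_m is irreducible for some m ≥ 1, then X_m is reduced. -/

import Mathlib

noncomputable section

/-- The universal substitution `U_i ↦ ∑_j X_{i,j} t^j` computing the equations of jet schemes:
a polynomial `f` in the variables `σ` is sent to a polynomial in `t` whose coefficients are the
equations of the jet scheme of `V(f)`. -/
def jetSub (k : Type*) [CommRing k] (σ : Type*) (m : ℕ) :
    MvPolynomial σ k →ₐ[k] Polynomial (MvPolynomial (σ × Fin (m + 1)) k) :=
  MvPolynomial.aeval fun i =>
    ∑ j : Fin (m + 1), Polynomial.C (MvPolynomial.X (i, j)) * Polynomial.X ^ (j : ℕ)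

/-- The ideal of the `m`-th jet scheme of the closed subscheme of affine space `Spec k[σ]`
defined by the equations in `F`: it is generated by the coefficients of `t^l`, `0 ≤ l ≤ m`,
of the universal substitutions of the elements of `F`. -/
def jetIdeal (k : Type*) [CommRing k] (σ : Type*) (m : ℕ)
    (F : Set (MvPolynomial σ k)) : Ideal (MvPolynomial (σ × Fin (m + 1)) k) :=
  Ideal.span {g | ∃ f ∈ F, ∃ l ≤ m, g = Polynomial.coeff (jetSub k σ m f) l}

/-- The ideal of the fiber `π_m⁻¹(x)` of the `m`-th jet scheme over the point `x`. -/
def jetFiberIdeal (k : Type*) [CommRing k] (σ : Type*) (m : ℕ)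
    (F : Set (MvPolynomial σ k)) (x : σ → k) : Ideal (MvPolynomial (σ × Fin (m + 1)) k) :=
  jetIdeal k σ m F ⊔
    Ideal.span (Set.range fun i : σ =>
      MvPolynomial.X (i, (0 : Fin (m + 1))) - MvPolynomial.C (x i))

/-- The ideal of the locus `π_m⁻¹(Z)` of `m`-jets lying over the closed subscheme `Z = V(G)`. -/
def jetOverIdeal (k : Type*) [CommRing k] (σ : Type*) (m : ℕ)
    (F G : Set (MvPolynomial σ k)) : Ideal (MvPolynomial (σ × Fin (m + 1)) k) :=
  jetIdeal k σ m F ⊔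
    Ideal.span ((MvPolynomial.rename fun i : σ => (i, (0 : Fin (m + 1)))) '' G)

/-- The Zariski tangent space at a point `x` of the subvariety of affine space cut out by the
equations `F`, namely the common kernel of the differentials at `x`. -/
def tangentSpaceAt (k : Type*) [Field k] {σ : Type*} [Fintype σ]
    (F : Set (MvPolynomial σ k)) (x : σ → k) : Submodule k (σ → k) :=
  ⨅ f ∈ F, LinearMap.ker (∑ i : σ,
    MvPolynomial.eval x (MvPolynomial.pderiv i f) •
      (LinearMap.proj i : (σ → k) →ₗ[k] k))

section

open IsLocalRing RingTheory.Sequence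

theorem IsLocalRing.exists_finset_span_insert_eq_maximalIdeal {S : Type*} [CommRing S]
    [IsLocalRing S] [IsNoetherianRing S] {x : S} (hx : x ∈ maximalIdeal S)
    (hx2 : x ∉ maximalIdeal S ^ 2) :
    ∃ s : Finset S, s.card + 1 ≤ (maximalIdeal S).spanFinrank ∧
      Ideal.span (insert x (s : Set S)) = maximalIdeal S := by
  classical
  set v : CotangentSpace S := (maximalIdeal S).toCotangent ⟨x, hx⟩ with hv
  have hv0 : v ≠ 0 := by
    rw [hv, Ne, Ideal.toCotangent_eq_zero]
    exact hx2
  let W : Submodule (ResidueField S) (CotangentSpace S) := Submodule.span _ {v}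
  have hW : Module.finrank (ResidueField S) (CotangentSpace S ⧸ W) + 1 =
      (maximalIdeal S).spanFinrank := by
    rw [spanFinrank_maximalIdeal_eq_finrank_cotangentSpace, ← W.finrank_quotient_add_finrank,
      finrank_span_singleton hv0]
  let b := Module.finBasis (ResidueField S) (CotangentSpace S ⧸ W)
  have hb : ∀ i, ∃ y : maximalIdeal S, W.mkQ ((maximalIdeal S).toCotangent y) = b i := fun i => by
    obtain ⟨z, hz⟩ := W.mkQ_surjective (b i)
    obtain ⟨y, rfl⟩ := (maximalIdeal S).toCotangent_surjective z
    exact ⟨y, hz⟩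
  choose y hy using hb
  have hspan : Ideal.span (insert x (Set.range fun i => (y i : S))) = maximalIdeal S := by
    have := (maximalIdeal S).fg_of_isNoetherianRing
    refine le_antisymm ?_ ?_
    · rw [Ideal.span_le, Set.insert_subset_iff]
      refine ⟨hx, ?_⟩
      rintro _ ⟨i, rfl⟩
      exact (y i).2
    · refine Submodule.le_of_le_smul_of_le_jacobson_bot (I := maximalIdeal S) this
        (IsLocalRing.maximalIdeal_le_jacobson _) ?_
      intro z hz
      obtain ⟨a, ha⟩ : ∃ a : S, ∃ c : Fin _ → S,
          (maximalIdeal S).toCotangent ⟨z, hz⟩ =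
          a • (maximalIdeal S).toCotangent ⟨x, hx⟩ +
            ∑ i, c i • (maximalIdeal S).toCotangent (y i) := by
        have h1 := b.sum_repr (W.mkQ ((maximalIdeal S).toCotangent ⟨z, hz⟩))
        choose c hc using fun i => IsLocalRing.residue_surjective (R := S)
          (b.repr (W.mkQ ((maximalIdeal S).toCotangent ⟨z, hz⟩)) i)
        have h2 : (maximalIdeal S).toCotangent ⟨z, hz⟩ -
            ∑ i, c i • (maximalIdeal S).toCotangent (y i) ∈ W := by
          rw [← Submodule.Quotient.mk_eq_zero W, ← Submodule.mkQ_apply, map_sub, sub_eq_zero, ← h1,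
            map_sum]
          refine Finset.sum_congr rfl fun i _ => ?_
          rw [← hc, ← hy]
          exact (map_smul W.mkQ (residue S (c i)) _).symm
        obtain ⟨a, ha⟩ := Submodule.mem_span_singleton.mp h2
        obtain ⟨a, rfl⟩ := IsLocalRing.residue_surjective a
        refine ⟨a, c, ?_⟩
        rw [← sub_eq_iff_eq_add]
        exact ha.symm
      obtain ⟨c, hc⟩ := ha
      have h3 : z - (a * x + ∑ i, c i * y i) ∈ maximalIdeal S ^ 2 := by
        have : (maximalIdeal S).toCotangent ⟨z, hz⟩ = (maximalIdeal S).toCotangent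
            (a • ⟨x, hx⟩ + ∑ i, c i • y i) := by
          rw [hc, map_add, map_sum, map_smul]
          simp only [map_smul]
        have := (Ideal.toCotangent_eq _).mp this
        simpa using this
      rw [← sub_add_cancel z (a * x + ∑ i, c i * y i), add_comm]
      refine Submodule.add_mem_sup ?_ ?_
      · refine Ideal.add_mem _ (Ideal.mul_mem_left _ _ (Ideal.subset_span (Set.mem_insert _ _)))
          (Ideal.sum_mem _ fun i _ => Ideal.mul_mem_left _ _ (Ideal.subset_span
            (Set.mem_insert_of_mem _ ⟨i, rfl⟩)))
      · simpa [pow_two] using h3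
  refine ⟨Finset.univ.image fun i => (y i : S), ?_, by simpa using hspan⟩
  rw [← hW]
  exact Nat.succ_le_succ (Finset.card_image_le.trans (by simp))

theorem IsRegularLocalRing.exists_isRegularLocalRing_quotient {S : Type*} [CommRing S]
    [IsRegularLocalRing S] {d : ℕ} (hd : ringKrullDim S = (d + 1 : ℕ)) :
    ∃ x ∈ maximalIdeal S, (∀ p ∈ minimalPrimes S, x ∉ p) ∧
      IsRegularLocalRing (S ⧸ Ideal.span {x}) ∧ ringKrullDim (S ⧸ Ideal.span {x}) = d := by
  classical
  have hm := (isRegularLocalRing_iff S).mp ‹_›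
  rw [hd] at hm
  have hm' : (maximalIdeal S).spanFinrank = d + 1 := by exact_mod_cast hm
  have hfin : (minimalPrimes S).Finite := minimalPrimes.finite_of_isNoetherianRing S
  have havoid : ¬ ((maximalIdeal S : Set S) ⊆
      ⋃ i ∈ ((insert (maximalIdeal S ^ 2) hfin.toFinset : Finset (Ideal S)) : Set (Ideal S)),
        (i : Set S)) := by
    refine fun h => ?_
    have h := (Ideal.subset_union_prime (f := fun i : Ideal S => i) (maximalIdeal S ^ 2)
      (maximalIdeal S ^ 2) ?_).mp h
    · obtain ⟨i, hi, hle⟩ := h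
      rw [Finset.mem_insert, Set.Finite.mem_toFinset] at hi
      obtain rfl | hi := hi
      · have : maximalIdeal S = ⊥ := by
          refine Submodule.eq_bot_of_le_smul_of_le_jacobson_bot (maximalIdeal S) _
            (maximalIdeal S).fg_of_isNoetherianRing ?_ (IsLocalRing.maximalIdeal_le_jacobson _)
          simpa [pow_two] using hle
        rw [this, Submodule.spanFinrank_bot] at hm'
        omega
      · have h1 : maximalIdeal S = i := le_antisymm hle (IsLocalRing.le_maximalIdeal hi.1.1.ne_top)
        have h2 := IsLocalRing.maximalIdeal_height_eq_ringKrullDim (R := S)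
        have h3 : (maximalIdeal S).height = 0 := by
          rw [Ideal.height_eq_zero_iff, h1]
          exact hi
        rw [h3, hd] at h2
        norm_cast at h2
    · intro i hi h1 _
      rw [Finset.mem_insert, Set.Finite.mem_toFinset] at hi
      exact (hi.resolve_left h1).1.1
  obtain ⟨x, hx, hx2⟩ := Set.not_subset.mp havoid
  simp only [Set.mem_iUnion, not_exists, Finset.coe_insert, Set.Finite.coe_toFinset,
    Set.mem_insert_iff, forall_eq_or_imp, SetLike.mem_coe] at hx hx2
  refine ⟨x, hx, fun p hp => hx2.2 p hp, ?_⟩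
  obtain ⟨s, hs, hspan⟩ := exists_finset_span_insert_eq_maximalIdeal hx hx2.1
  have hne : Ideal.span {x} ≠ ⊤ := fun h => (maximalIdeal.isMaximal S).ne_top
    (top_le_iff.mp (h ▸ (Ideal.span_singleton_le_iff_mem _).mpr hx))
  have := Ideal.Quotient.nontrivial_iff.mpr hne
  have : IsLocalRing (S ⧸ Ideal.span {x}) :=
    IsLocalRing.of_surjective' _ Ideal.Quotient.mk_surjective
  have hmap : maximalIdeal (S ⧸ Ideal.span {x}) =
      Ideal.span (Ideal.Quotient.mk (Ideal.span {x}) '' s) := by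
    have h1 : (maximalIdeal S).map (Ideal.Quotient.mk (Ideal.span {x})) =
        maximalIdeal (S ⧸ Ideal.span {x}) :=
      IsLocalRing.map_maximalIdeal_of_surjective _ Ideal.Quotient.mk_surjective
    rw [← h1, ← hspan, Ideal.map_span, Set.image_insert_eq, Ideal.span_insert,
      Ideal.Quotient.eq_zero_iff_mem.mpr (Ideal.mem_span_singleton_self x)]
    simp
  have hle : (maximalIdeal (S ⧸ Ideal.span {x})).spanFinrank ≤ d := by
    rw [hmap]
    refine (Submodule.spanFinrank_span_le_ncard_of_finite (s.finite_toSet.image _)).trans ?_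
    refine (Set.ncard_image_le s.finite_toSet).trans ?_
    rw [Set.ncard_coe_finset]
    omega
  have hdim : (d : WithBot ℕ∞) ≤ ringKrullDim (S ⧸ Ideal.span {x}) := by
    have := Ideal.height_le_ringKrullDim_quotient_add_one hx
    rw [IsLocalRing.maximalIdeal_height_eq_ringKrullDim, hd] at this
    push_cast at this
    exact (ENat.WithBot.add_le_add_one_right_iff).mp this
  have hreg : IsRegularLocalRing (S ⧸ Ideal.span {x}) := .of_spanFinrank_maximalIdeal_le _
    (le_trans (by exact_mod_cast hle) hdim)
  refine ⟨hreg, le_antisymm ?_ hdim⟩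
  rw [← (isRegularLocalRing_iff _).mp hreg]
  exact_mod_cast hle

theorem IsRegularLocalRing.isDomain_and_exists_isRegular {S : Type*} [CommRing S]
    [IsRegularLocalRing S] (d : ℕ) (hd : ringKrullDim S = d) :
    IsDomain S ∧ ∃ rs : List S, rs.length = d ∧ (∀ r ∈ rs, r ∈ maximalIdeal S) ∧
      IsRegular S rs := by
  induction d generalizing S with
  | zero =>
    have hm := (isRegularLocalRing_iff S).mp ‹_›
    rw [hd] at hm
    have h0 : maximalIdeal S = ⊥ := by
      rw [← Submodule.spanFinrank_eq_zero_iff_eq_bot (maximalIdeal S).fg_of_isNoetherianRing]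
      exact_mod_cast hm
    exact ⟨(IsLocalRing.isField_iff_maximalIdeal_eq.mpr h0).isDomain, [], rfl, by simp,
      IsRegular.nil S S⟩
  | succ d ih =>
    obtain ⟨x, hx, hmin, hreg, hdim⟩ := exists_isRegularLocalRing_quotient hd
    obtain ⟨hdom, rs, hlen, hmem, hrs⟩ := ih hdim
    have hprime : (Ideal.span {x}).IsPrime := (Ideal.Quotient.isDomain_iff_prime _).mp hdom
    have hS : IsDomain S := by
      obtain ⟨q, hq, hqx⟩ := Ideal.exists_minimalPrimes_le (bot_le (a := Ideal.span {x}))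
      have : q = ⊥ := by
        refine Submodule.eq_bot_of_le_smul_of_le_jacobson_bot (maximalIdeal S) _
          q.fg_of_isNoetherianRing ?_ (IsLocalRing.maximalIdeal_le_jacobson _)
        intro y hy
        obtain ⟨a, rfl⟩ := Ideal.mem_span_singleton'.mp (hqx hy)
        rw [mul_comm, smul_eq_mul]
        exact Ideal.mul_mem_mul hx ((hq.1.1.mem_or_mem hy).resolve_right (hmin q hq))
      subst this
      have := hq.1.1
      exact IsDomain.of_bot_isPrime S
    refine ⟨hS, ?_⟩
    have hx0 : x ≠ 0 := fun h => by
      refine hmin ⊥ ?_ (by simp [h])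
      rw [IsDomain.minimalPrimes_eq_singleton_bot]; rfl
    choose lift hlift using Ideal.Quotient.mk_surjective (I := Ideal.span {x})
    have hmap : (rs.map lift).map (Ideal.Quotient.mk (Ideal.span {x})) = rs := by
      simp [Function.comp_def, hlift]
    have hmem' : ∀ r ∈ x :: rs.map lift, r ∈ maximalIdeal S := by
      intro r hr
      rw [List.mem_cons] at hr
      obtain rfl | hr := hr
      · exact hx
      · obtain ⟨t, ht, rfl⟩ := List.mem_map.mp hr
        have h1 := hmem t ht
        rw [← hlift t, IsLocalRing.mem_maximalIdeal, mem_nonunits_iff] at h1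
        rw [IsLocalRing.mem_maximalIdeal, mem_nonunits_iff]
        exact fun hu => h1 (hu.map _)
    refine ⟨x :: rs.map lift, by simp [hlen], hmem', ?_⟩
    refine IsRegular.of_isWeaklyRegular_of_mem_maximalIdeal _ hmem' ?_
    refine IsWeaklyRegular.cons (IsSMulRegular.of_ne_zero hx0) ?_
    let e : QuotSMulTop x S ≃ₗ[S] S ⧸ Ideal.span {x} :=
      Submodule.quotEquivOfEq _ _ (by simp [← Submodule.ideal_span_singleton_smul])
    rw [e.isWeaklyRegular_congr, ← isWeaklyRegular_map_algebraMap_iff (S ⧸ Ideal.span {x}),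
      Ideal.Quotient.algebraMap_eq, hmap]
    exact hrs.1

section Depth

open CategoryTheory Abelian Limits Pointwise

universe u

theorem IsLocalRing.exists_isRegular_quotSMulTop {S : Type u} [CommRing S] [IsLocalRing S]
    [IsNoetherianRing S] {M : Type u} [AddCommGroup M] [Module S M] [Module.Finite S M]
    [Nontrivial M] {h : ℕ} {rs : List S} (hrs : rs.length = h + 1)
    (hmem : ∀ r ∈ rs, r ∈ maximalIdeal S) (hreg : IsRegular M rs) {g : S}
    (hg : g ∈ maximalIdeal S) (hgM : IsSMulRegular M g) :
    ∃ rs' : List S, rs'.length = h ∧ (∀ r ∈ rs', r ∈ maximalIdeal S) ∧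
      IsRegular (QuotSMulTop g M) rs' := by
  have lt_top (L : Type u) [AddCommGroup L] [Module S L] [Module.Finite S L] [Nontrivial L] :
      maximalIdeal S • (⊤ : Submodule S L) < ⊤ :=
    (Submodule.top_ne_ideal_smul_of_le_jacobson_annihilator
      (maximalIdeal_le_jacobson _)).symm.lt_top
  have hnt : Nontrivial (QuotSMulTop g M) := nontrivial_quotSMulTop_of_mem_maximalIdeal M hg
  let K : ModuleCat.{u} S := ModuleCat.of S (S ⧸ maximalIdeal S)
  have hK : Module.support S K = PrimeSpectrum.zeroLocus (maximalIdeal S) := by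
    rw [Module.support_eq_zeroLocus]
    change PrimeSpectrum.zeroLocus (Module.annihilator S (S ⧸ maximalIdeal S) : Set S) = _
    rw [Ideal.annihilator_quotient]
  have hKfin : Module.Finite S K := inferInstanceAs (Module.Finite S (S ⧸ maximalIdeal S))
  have key := ModuleCat.subsingleton_ext_of_exists_isRegular (maximalIdeal S) K hK.subset
    (ModuleCat.of S M) (lt_top M) rs hmem hreg
  refine ModuleCat.exists_isRegular_of_exists_subsingleton_ext (maximalIdeal S) h
    (ModuleCat.of S (QuotSMulTop g M)) (lt_top _) K hK fun i hi => ?_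
  have zero1 := AddCommGrpCat.isZero_of_iff_subsingleton.mpr (key i (by omega))
  have zero2 := AddCommGrpCat.isZero_of_iff_subsingleton.mpr (key (i + 1) (by omega))
  have hgM' : IsSMulRegular (ModuleCat.of S M) g := hgM
  exact AddCommGrpCat.subsingleton_of_isZero <| ShortComplex.Exact.isZero_of_both_zeros
    ((Ext.covariant_sequence_exact₃' K hgM'.smulShortComplex_shortExact) i (i + 1) rfl)
    (zero1.eq_zero_of_src _) (zero2.eq_zero_of_tgt _)

theorem IsLocalRing.length_le_of_exists_smul_eq_zero {S : Type u} [CommRing S] [IsLocalRing S]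
    [IsNoetherianRing S] (gs : List S) (hgs : ∀ g ∈ gs, g ∈ maximalIdeal S)
    {M : Type u} [AddCommGroup M] [Module S M] [Module.Finite S M]
    [Nontrivial M] {rs : List S} (hmem : ∀ r ∈ rs, r ∈ maximalIdeal S) (hreg : IsRegular M rs)
    (hgM : IsWeaklyRegular M gs)
    (hv : ∃ v : M ⧸ (Ideal.ofList gs • ⊤ : Submodule S M), v ≠ 0 ∧
      ∀ a ∈ maximalIdeal S, a • v = 0) : rs.length ≤ gs.length := by
  induction gs generalizing M rs with
  | nil =>
    cases rs with
    | nil => simp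
    | cons r rs =>
      exfalso
      obtain ⟨v, hv0, hv⟩ := hv
      obtain ⟨w, rfl⟩ := Submodule.Quotient.mk_surjective _ v
      have h1 := hv r (hmem r (by simp))
      rw [← Submodule.Quotient.mk_smul, Submodule.Quotient.mk_eq_zero] at h1
      rw [Ne, Submodule.Quotient.mk_eq_zero] at hv0
      simp only [Ideal.ofList_nil, Submodule.bot_smul, Submodule.mem_bot] at h1 hv0
      rw [isRegular_cons_iff] at hreg
      exact hv0 (isSMulRegular_iff_right_eq_zero_of_smul.mp hreg.1 w h1)
  | cons g gs ih =>
    rcases hlen : rs.length with _ | h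
    · simp
    · rw [isWeaklyRegular_cons_iff] at hgM
      have hg : g ∈ maximalIdeal S := hgs g (by simp)
      have hnt : Nontrivial (QuotSMulTop g M) := nontrivial_quotSMulTop_of_mem_maximalIdeal M hg
      obtain ⟨rs', hl, hm', hr'⟩ :=
        IsLocalRing.exists_isRegular_quotSMulTop hlen hmem hreg hg hgM.1
      have := ih (fun x hx => hgs x (by simp [hx])) hm' hr' hgM.2 ?_
      · simp; omega
      · obtain ⟨v, hv0, hv⟩ := hv
        let e := Submodule.quotOfListConsSMulTopEquivQuotSMulTopInner M g gs
        exact ⟨e v, by simpa using hv0, fun a ha => by rw [← map_smul, hv a ha, map_zero]⟩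

end Depth

theorem IsRegularRing.height_le_length_of_mem_associatedPrimes {R : Type*} [CommRing R]
    [IsRegularRing R] {gs : List R} (hgs : IsWeaklyRegular R gs) {q : Ideal R}
    (hq : q ∈ associatedPrimes R (R ⧸ Ideal.ofList gs)) : q.height ≤ gs.length := by
  obtain ⟨hqp, x, hx⟩ := isAssociatedPrime_iff.mp hq
  obtain ⟨y, rfl⟩ := Ideal.Quotient.mk_surjective x
  have hmem (a : R) : a ∈ q ↔ a * y ∈ Ideal.ofList gs := by
    rw [hx, Submodule.mem_colon_singleton, Submodule.mem_bot, ← Ideal.Quotient.eq_zero_iff_mem,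
      map_mul]
    rfl
  let S := Localization.AtPrime q
  have hle : Ideal.ofList gs ≤ q := fun a ha => (hmem a).mpr (Ideal.mul_mem_right _ _ ha)
  have hfin : (q.height : WithBot ℕ∞) = (q.height.toNat : ℕ) := by
    rw [← ENat.natCast_toNat (Ideal.height_ne_top hqp.ne_top)]
    rfl
  obtain ⟨-, rs, hlen, hrs, hreg⟩ :=
    IsRegularLocalRing.isDomain_and_exists_isRegular (S := S) q.height.toNat
      (by rw [IsLocalization.AtPrime.ringKrullDim_eq_height q S, hfin])
  have hwr := hgs.of_isLocalization S q.primeCompl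
  have hmax (a : R) (ha : a ∈ q) : algebraMap R S a ∈ maximalIdeal S :=
    (IsLocalization.AtPrime.to_map_mem_maximal_iff S q a).mpr ha
  have := IsLocalRing.length_le_of_exists_smul_eq_zero (gs.map (algebraMap R S))
    (by
      intro g hg
      obtain ⟨a, ha, rfl⟩ := List.mem_map.mp hg
      exact hmax a (hle (Ideal.subset_span ha))) hrs hreg hwr
    ⟨Submodule.Quotient.mk (algebraMap R S y), ?_, ?_⟩
  · rw [List.length_map, hlen] at this
    rw [← ENat.natCast_toNat (Ideal.height_ne_top hqp.ne_top)]
    exact_mod_cast this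
  · rw [Ne, Submodule.Quotient.mk_eq_zero, smul_eq_mul, Ideal.mul_top, ← Ideal.map_ofList,
      IsLocalization.algebraMap_mem_map_algebraMap_iff q.primeCompl]
    rintro ⟨s, hs, hsy⟩
    exact hs ((hmem s).mpr hsy)
  · intro a ha
    rw [← Submodule.Quotient.mk_smul, Submodule.Quotient.mk_eq_zero, smul_eq_mul, smul_eq_mul,
      Ideal.mul_top, ← Ideal.map_ofList]
    rw [← Localization.AtPrime.map_eq_maximalIdeal] at ha
    have h2 := Ideal.mul_mem_mul ha (Ideal.mem_span_singleton_self (algebraMap R S y))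
    rw [← Set.image_singleton, ← Ideal.map_span, ← Ideal.map_mul] at h2
    refine Ideal.map_mono (Ideal.mul_le.mpr fun b hb c hc => ?_) h2
    obtain ⟨d, rfl⟩ := Ideal.mem_span_singleton'.mp hc
    rw [show b * (d * y) = d * (b * y) by ring]
    exact Ideal.mul_mem_left _ _ ((hmem b).mp hb)

theorem Submodule.exists_mem_notMem_of_infinite {k E ι : Type*} [Field k] [Infinite k]
    [AddCommGroup E] [Module k E] (V : Submodule k E) {s : Set ι} (hs : s.Finite)
    (W : ι → Submodule k E) (hW : ∀ i ∈ s, ¬ V ≤ W i) : ∃ v ∈ V, ∀ i ∈ s, v ∉ W i := by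
  by_contra! hcon
  have := hs.to_subtype
  obtain ⟨i, hi⟩ := Subspace.exists_eq_top_of_iUnion_eq_univ (k := k) (E := V)
    (p := fun i : s => (W i).comap V.subtype) (by
      refine Set.eq_univ_of_forall fun v => ?_
      obtain ⟨i, hi, hv⟩ := hcon v v.2
      exact Set.mem_iUnion.mpr ⟨⟨i, hi⟩, hv⟩)
  exact hW i i.2 (Submodule.comap_subtype_eq_top.mp hi)

theorem IsRegularRing.exists_isWeaklyRegular_of_le_height {k R : Type*} [Field k] [Infinite k]
    [CommRing R] [Algebra k R] [IsRegularRing R] (V : Submodule k R) [FiniteDimensional k V]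
    (hne : Ideal.span (V : Set R) ≠ ⊤) (i : ℕ) (hi : i ≤ (Ideal.span (V : Set R)).height) :
    ∃ gs : List R, gs.length = i ∧ (∀ g ∈ gs, g ∈ V) ∧ IsWeaklyRegular R gs ∧
      i ≤ Module.finrank k (Submodule.span k {x | x ∈ gs}) := by
  induction i with
  | zero => exact ⟨[], by simp⟩
  | succ i ih =>
    obtain ⟨gs, hlen, hV, hreg, hrank⟩ := ih (le_trans (by simp) hi)
    let K : Ideal R := Ideal.ofList gs
    have hK : K ≤ Ideal.span (V : Set R) := Ideal.span_mono hV
    have hnt : Nontrivial (R ⧸ K) :=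
      Ideal.Quotient.nontrivial_iff.mpr fun h => hne (top_le_iff.mp (h ▸ hK))
    obtain ⟨g, hgV, hg⟩ := V.exists_mem_notMem_of_infinite (associatedPrimes.finite R (R ⧸ K))
      (fun q => q.restrictScalars k) (fun q hq hle => by
        have h1 := IsRegularRing.height_le_length_of_mem_associatedPrimes hreg hq
        have h2 := hi.trans (Ideal.height_mono (Ideal.span_le.mpr hle : _ ≤ q))
        have h3 := h2.trans h1
        rw [hlen] at h3
        norm_cast at h3
        omega)
    have hgreg : IsSMulRegular (R ⧸ K) g := by
      have := biUnion_associatedPrimes_eq_compl_regular R (R ⧸ K)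
      by_contra hcon
      have h2 : g ∈ {r : R | IsSMulRegular (R ⧸ K) r}ᶜ := hcon
      rw [← this] at h2
      obtain ⟨q, hq, hgq⟩ := Set.mem_iUnion₂.mp h2
      exact hg q hq hgq
    refine ⟨gs ++ [g], by simp [hlen], ?_, ?_, ?_⟩
    · intro x hx
      rcases List.mem_append.mp hx with h | h
      · exact hV x h
      · rw [List.mem_singleton.mp h]; exact hgV
    · rw [isWeaklyRegular_append_iff, isWeaklyRegular_singleton_iff]
      refine ⟨hreg, ?_⟩
      rwa [smul_eq_mul, Ideal.mul_top]
    · have hfd : FiniteDimensional k (Submodule.span k {x | x ∈ gs ++ [g]}) :=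
        FiniteDimensional.span_of_finite k (List.finite_toSet _)
      refine hrank.trans_lt (Submodule.finrank_lt_finrank_of_lt (lt_of_le_of_ne ?_ ?_))
      · exact Submodule.span_mono fun x hx => List.mem_append_left _ hx
      · intro heq
        obtain ⟨q, hq⟩ := associatedPrimes.nonempty R (R ⧸ K)
        have hle : K ≤ q := by
          have := hq.annihilator_le
          rwa [Submodule.annihilator_top, Ideal.annihilator_quotient] at this
        refine hg q hq ?_
        have h1 : g ∈ Submodule.span k {x | x ∈ gs} := by
          rw [heq]; exact Submodule.subset_span (by simp)
        have h2 : Submodule.span k {x | x ∈ gs} ≤ q.restrictScalars k :=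
          Submodule.span_le.mpr fun x hx => hle (Ideal.subset_span hx)
        exact h2 h1

theorem IsRegularRing.height_le_of_mem_associatedPrimes_span {k R : Type*} [Field k] [Infinite k]
    [CommRing R] [Algebra k R] [IsRegularRing R] (V : Submodule k R) [FiniteDimensional k V]
    (hne : Ideal.span (V : Set R) ≠ ⊤) (r : ℕ) (hV : Module.finrank k V ≤ r)
    (hr : r ≤ (Ideal.span (V : Set R)).height) {q : Ideal R}
    (hq : q ∈ associatedPrimes R (R ⧸ Ideal.span (V : Set R))) : q.height ≤ r := by
  obtain ⟨gs, hlen, hgV, hreg, hrank⟩ :=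
    IsRegularRing.exists_isWeaklyRegular_of_le_height V hne r hr
  have hspan : Submodule.span k {x | x ∈ gs} = V :=
    Submodule.eq_of_le_of_finrank_le (Submodule.span_le.mpr hgV) (hV.trans hrank)
  have hK : Ideal.ofList gs = Ideal.span (V : Set R) := by
    refine le_antisymm (Ideal.span_mono hgV) (Ideal.span_le.mpr ?_)
    rw [← hspan]
    have : Submodule.span k {x | x ∈ gs} ≤ (Ideal.ofList gs).restrictScalars k :=
      Submodule.span_le.mpr fun x hx => Ideal.subset_span hx
    exact this
  rw [← hK] at hq
  exact (IsRegularRing.height_le_length_of_mem_associatedPrimes hreg hq).trans (by rw [hlen])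

theorem IsRegularRing.isRadical_span_of_isPrime_radical {k R : Type*} [Field k] [Infinite k]
    [CommRing R] [Algebra k R] [IsRegularRing R] (V : Submodule k R) [FiniteDimensional k V]
    {P : Ideal R} (hP : P.IsPrime) (hrad : (Ideal.span (V : Set R)).radical = P)
    (hV : Module.finrank k V ≤ P.height)
    (hloc : ∀ x ∈ P, ∃ s ∉ P, s * x ∈ Ideal.span (V : Set R)) :
    (Ideal.span (V : Set R)).IsRadical := by
  set J := Ideal.span (V : Set R) with hJ
  have hJP : J ≤ P := hrad ▸ Ideal.le_radical
  have hle (q : Ideal R) (hq : q.IsPrime) (hJq : J ≤ q) : P ≤ q :=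
    hrad ▸ hq.radical_le_iff.mpr hJq
  have hPJ : P ≤ J := by
    obtain ⟨r, hr⟩ := ENat.ne_top_iff_exists.mp (Ideal.height_ne_top hP.ne_top)
    have hJh : (r : ℕ∞) ≤ J.height := by
      rw [hr, J.height_eq_inf_minimalPrimes]
      exact le_iInf₂ fun q hq => Ideal.height_mono (hle q hq.1.1 hq.1.2)
    intro x hx
    by_contra hxJ
    obtain ⟨s, hs, hsx⟩ := hloc x hx
    obtain ⟨q, hq, hsq⟩ := exists_le_isAssociatedPrime_of_isNoetherianRing R
      (Ideal.Quotient.mk J x) (by rwa [Ne, Ideal.Quotient.eq_zero_iff_mem])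
    have hqh := IsRegularRing.height_le_of_mem_associatedPrimes_span V
      (ne_top_of_le_ne_top hP.ne_top hJP) r (by rw [← hr] at hV; exact_mod_cast hV) hJh hq
    have hqJ : J ≤ q := by
      have := hq.annihilator_le
      rwa [Submodule.annihilator_top, Ideal.annihilator_quotient] at this
    have hqp := hq.isPrime
    have hPq : P = q := by
      by_contra hne
      have := Ideal.height_strict_mono_of_isPrime ((hle q hqp hqJ).lt_of_ne hne)
      exact absurd (this.trans_le hqh) (by rw [hr]; exact lt_irrefl _)
    refine hs (hPq ▸ hsq ?_)
    rw [Submodule.mem_colon_singleton, Submodule.mem_bot]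
    exact (Ideal.Quotient.eq_zero_iff_mem).mpr hsx
  rw [le_antisymm hJP hPJ]
  exact hP.isRadical

theorem Derivation.apply_mem_of_mem_sq {k R : Type*} [CommRing k] [CommRing R] [Algebra k R]
    (D : Derivation k R R) {P : Ideal R} {x : R} (hx : x ∈ P ^ 2) : D x ∈ P := by
  rw [sq] at hx
  refine Submodule.mul_induction_on hx (fun a ha b hb => ?_) fun a b ha hb => ?_
  · rw [D.leibniz]
    exact P.add_mem (P.mul_mem_right _ ha) (P.mul_mem_right _ hb)
  · rw [map_add]
    exact P.add_mem ha hb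

section Jacobian

variable {k R ι κ : Type*} [CommRing k] [CommRing R] [Algebra k R] [Fintype ι]
  (D : κ → Derivation k R R) (g : ι → R) {P : Ideal R} [hP : P.IsPrime]

include hP in
theorem Ideal.mem_of_sum_mul_mem_sq (hgP : ∀ i, g i ∈ P)
    (hg : ∀ a : ι → R, (∀ s, ∑ i, a i * D s (g i) ∈ P) → ∀ i, a i ∈ P) {t : R} (ht : t ∉ P)
    (a : ι → R) (ha : t * ∑ i, a i * g i ∈ P ^ 2) (i : ι) : a i ∈ P := by
  refine (hP.mem_or_mem (hg (fun i => t * a i) (fun s => ?_) i)).resolve_left ht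
  have h1 := (D s).apply_mem_of_mem_sq ha
  rw [Finset.mul_sum, map_sum] at h1
  have h2 : ∑ i, D s (t * (a i * g i)) =
      ∑ i, t * a i * D s (g i) + ∑ i, g i * D s (t * a i) := by
    rw [← Finset.sum_add_distrib]
    refine Finset.sum_congr rfl fun i _ => ?_
    rw [← mul_assoc, (D s).leibniz, smul_eq_mul, smul_eq_mul]
  rw [h2] at h1
  exact (P.add_mem_iff_left (P.sum_mem fun i _ => P.mul_mem_right _ (hgP i))).mp h1

theorem Ideal.linearIndependent_toCotangent_localization (hgP : ∀ i, g i ∈ P)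
    (hg : ∀ a : ι → R, (∀ s, ∑ i, a i * D s (g i) ∈ P) → ∀ i, a i ∈ P) :
    LinearIndependent (IsLocalRing.ResidueField (Localization.AtPrime P)) fun i =>
      (maximalIdeal (Localization.AtPrime P)).toCotangent
        ⟨algebraMap R _ (g i),
          (IsLocalization.AtPrime.to_map_mem_maximal_iff _ P _).mpr (hgP i)⟩ := by
  rw [Fintype.linearIndependent_iff]
  intro c hc
  choose α hα using fun i => IsLocalRing.residue_surjective (c i)
  obtain ⟨b, hb⟩ := IsLocalization.exist_integer_multiples_of_finite P.primeCompl α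
  choose a ha using hb
  have h1 : (∑ i, α i * algebraMap R _ (g i)) ∈ maximalIdeal (Localization.AtPrime P) ^ 2 := by
    have h : (maximalIdeal (Localization.AtPrime P)).toCotangent (∑ i, α i •
        ⟨algebraMap R _ (g i),
          (IsLocalization.AtPrime.to_map_mem_maximal_iff _ P _).mpr (hgP i)⟩) = 0 := by
      rw [map_sum, ← hc]
      refine Finset.sum_congr rfl fun i _ => ?_
      rw [map_smul, ← hα i]
      rfl
    rw [Ideal.toCotangent_eq_zero] at h
    simpa using h
  have h2 : algebraMap R (Localization.AtPrime P) (∑ i, a i * g i) ∈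
      (P ^ 2).map (algebraMap R (Localization.AtPrime P)) := by
    rw [Ideal.map_pow, Localization.AtPrime.map_eq_maximalIdeal]
    have : algebraMap R (Localization.AtPrime P) (∑ i, a i * g i) =
        algebraMap R (Localization.AtPrime P) b * ∑ i, α i * algebraMap R _ (g i) := by
      rw [map_sum, Finset.mul_sum]
      refine Finset.sum_congr rfl fun i _ => ?_
      rw [map_mul, ha i, Algebra.smul_def, mul_assoc]
    rw [this]
    exact Ideal.mul_mem_left _ _ h1
  rw [IsLocalization.algebraMap_mem_map_algebraMap_iff P.primeCompl] at h2
  obtain ⟨t, ht, hta⟩ := h2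
  intro i
  have h3 := Ideal.mem_of_sum_mul_mem_sq D g hgP hg ht a hta i
  rw [← hα i, IsLocalRing.residue_eq_zero_iff]
  have h4 : algebraMap R (Localization.AtPrime P) (a i) ∈ maximalIdeal _ :=
    (IsLocalization.AtPrime.to_map_mem_maximal_iff _ P _).mpr h3
  rw [ha i, Algebra.smul_def] at h4
  refine ((maximalIdeal.isMaximal _).isPrime.mem_or_mem h4).resolve_left fun h5 => b.2 ?_
  exact (IsLocalization.AtPrime.to_map_mem_maximal_iff _ P _).mp h5

theorem Ideal.finrank_cotangentSpace_localization [IsRegularRing R] :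
    (Module.finrank (IsLocalRing.ResidueField (Localization.AtPrime P))
      (CotangentSpace (Localization.AtPrime P)) : ℕ∞) = P.height := by
  have hreg : IsRegularLocalRing (Localization.AtPrime P) := inferInstance
  have h := hreg.spanFinrank_maximalIdeal
  rw [IsLocalization.AtPrime.ringKrullDim_eq_height P,
    spanFinrank_maximalIdeal_eq_finrank_cotangentSpace] at h
  exact_mod_cast h

theorem Ideal.card_le_height_of_jacobian [IsRegularRing R] (hgP : ∀ i, g i ∈ P)
    (hg : ∀ a : ι → R, (∀ s, ∑ i, a i * D s (g i) ∈ P) → ∀ i, a i ∈ P) :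
    (Fintype.card ι : ℕ∞) ≤ P.height := by
  rw [← Ideal.finrank_cotangentSpace_localization]
  exact_mod_cast
    (Ideal.linearIndependent_toCotangent_localization D g hgP hg).fintype_card_le_finrank

theorem Ideal.exists_mul_mem_span_of_jacobian [IsRegularRing R] (hgP : ∀ i, g i ∈ P)
    (hg : ∀ a : ι → R, (∀ s, ∑ i, a i * D s (g i) ∈ P) → ∀ i, a i ∈ P)
    (hht : P.height ≤ Fintype.card ι) {x : R} (hx : x ∈ P) :
    ∃ s ∉ P, s * x ∈ Ideal.span (Set.range g) := by
  have hli := Ideal.linearIndependent_toCotangent_localization D g hgP hg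
  have hcard := (Ideal.card_le_height_of_jacobian D g hgP hg).antisymm hht
  rw [← Ideal.finrank_cotangentSpace_localization] at hcard
  have hspan := hli.span_eq_top_of_card_eq_finrank' (by exact_mod_cast hcard)
  let y (i : ι) : maximalIdeal (Localization.AtPrime P) :=
    ⟨algebraMap R _ (g i), (IsLocalization.AtPrime.to_map_mem_maximal_iff _ P _).mpr (hgP i)⟩
  have h1 : Submodule.span (IsLocalRing.ResidueField (Localization.AtPrime P))
      ((maximalIdeal (Localization.AtPrime P)).toCotangent '' Set.range y) = ⊤ := by
    rw [← Set.range_comp]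
    exact hspan
  rw [CotangentSpace.span_image_eq_top_iff] at h1
  have h2 : algebraMap R (Localization.AtPrime P) x ∈
      (Ideal.span (Set.range g)).map (algebraMap R (Localization.AtPrime P)) := by
    have h3 : (⟨algebraMap R _ x, (IsLocalization.AtPrime.to_map_mem_maximal_iff _ P _).mpr hx⟩ :
        maximalIdeal (Localization.AtPrime P)) ∈
          Submodule.span (Localization.AtPrime P) (Set.range y) := by
      rw [h1]; trivial
    have h4 := Submodule.mem_map_of_mem (f := (maximalIdeal _).subtype) h3
    rw [Submodule.map_span, ← Set.range_comp] at h4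
    rw [Ideal.map_span, ← Set.range_comp]
    exact h4
  rw [IsLocalization.algebraMap_mem_map_algebraMap_iff P.primeCompl] at h2
  exact h2

end Jacobian

end

section Jets

variable {k : Type*} [CommRing k] {σ : Type*} (m : ℕ)

@[simp]
theorem jetSub_X (i : σ) : jetSub k σ m (MvPolynomial.X i) =
    ∑ j : Fin (m + 1), Polynomial.C (MvPolynomial.X (i, j)) * Polynomial.X ^ (j : ℕ) :=
  MvPolynomial.aeval_X _ _

theorem pderiv_coeff_jetSub [DecidableEq σ] (s : σ × Fin (m + 1)) (f : MvPolynomial σ k) (l : ℕ) :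
    MvPolynomial.pderiv s ((jetSub k σ m f).coeff l) =
      (jetSub k σ m (MvPolynomial.pderiv s.1 f) * Polynomial.X ^ (s.2 : ℕ)).coeff l := by
  induction f using MvPolynomial.induction_on generalizing l with
  | C a =>
    rw [← MvPolynomial.algebraMap_eq, AlgHom.commutes, Derivation.map_algebraMap, map_zero,
      zero_mul, Polynomial.coeff_zero, Polynomial.algebraMap_apply, Polynomial.coeff_C]
    split_ifs
    · exact Derivation.map_algebraMap _ _
    · exact map_zero _
  | add p q hp hq => simp only [map_add, Polynomial.coeff_add, hp, hq, add_mul]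
  | mul_X p i hp =>
    have hX (l : ℕ) : MvPolynomial.pderiv s ((jetSub k σ m (MvPolynomial.X i)).coeff l) =
        (jetSub k σ m (MvPolynomial.pderiv s.1 (MvPolynomial.X i)) *
          Polynomial.X ^ (s.2 : ℕ)).coeff l := by
      obtain ⟨j, t⟩ := s
      rw [jetSub_X, Polynomial.finsetSum_coeff, map_sum, MvPolynomial.pderiv_X]
      by_cases hij : i = j
      · subst hij
        rw [Pi.single_eq_same, map_one, one_mul, Polynomial.coeff_X_pow,
          Finset.sum_eq_single t]
        · rw [Polynomial.coeff_C_mul, Polynomial.coeff_X_pow]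
          split_ifs <;> simp
        · intro b _ hb
          rw [Polynomial.coeff_C_mul, Polynomial.coeff_X_pow]
          split_ifs <;> simp [MvPolynomial.pderiv_X, hb]
        · simp
      · rw [Pi.single_eq_of_ne hij, map_zero, zero_mul, Polynomial.coeff_zero]
        refine Finset.sum_eq_zero fun b _ => ?_
        rw [Polynomial.coeff_C_mul, Polynomial.coeff_X_pow]
        split_ifs <;> simp [MvPolynomial.pderiv_X, hij]
    rw [Derivation.leibniz, smul_eq_mul, smul_eq_mul, map_mul, Polynomial.coeff_mul, map_sum,
      map_add, map_mul, map_mul, add_mul, Polynomial.coeff_add, mul_assoc,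
      mul_comm (jetSub k σ m (MvPolynomial.X i)), mul_assoc,
      mul_comm (jetSub k σ m (MvPolynomial.X i)),
      ← mul_assoc (jetSub k σ m (MvPolynomial.pderiv s.1 p)), Polynomial.coeff_mul,
      Polynomial.coeff_mul, ← Finset.sum_add_distrib]
    refine Finset.sum_congr rfl fun x _ => ?_
    rw [Derivation.leibniz, smul_eq_mul, smul_eq_mul, hX, hp, mul_comm (Polynomial.coeff _ x.2)]

theorem coeff_zero_mem_jetIdeal {F : Set (MvPolynomial σ k)} {f : MvPolynomial σ k}
    (hf : f ∈ Ideal.span F) : (jetSub k σ m f).coeff 0 ∈ jetIdeal k σ m F := by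
  have : Ideal.span F ≤ (jetIdeal k σ m F).comap
      (Polynomial.constantCoeff.comp (jetSub k σ m).toRingHom) :=
    Ideal.span_le.mpr fun f hf => Ideal.subset_span ⟨f, hf, 0, Nat.zero_le _, rfl⟩
  exact this hf

theorem jetIdeal_range {ι : Type*} (f : ι → MvPolynomial σ k) :
    jetIdeal k σ m (Set.range f) = Ideal.span (Set.range fun x : ι × Fin (m + 1) =>
      (jetSub k σ m (f x.1)).coeff x.2) := by
  refine congrArg Ideal.span (Set.ext fun g => ⟨?_, ?_⟩)
  · rintro ⟨_, ⟨i, rfl⟩, l, hl, rfl⟩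
    exact ⟨(i, ⟨l, by omega⟩), rfl⟩
  · rintro ⟨⟨i, l⟩, rfl⟩
    exact ⟨f i, ⟨i, rfl⟩, l, by omega, rfl⟩

/-- The map on coordinate rings induced by the zero section, which sends a point of the closed
subscheme defined by `I` to the constant jet at that point. -/
def constantJet (I : Ideal (MvPolynomial σ k)) :
    MvPolynomial (σ × Fin (m + 1)) k →ₐ[k] MvPolynomial σ k ⧸ I :=
  MvPolynomial.aeval fun s => if s.2 = 0 then Ideal.Quotient.mk I (MvPolynomial.X s.1) else 0

theorem map_constantJet_jetSub (I : Ideal (MvPolynomial σ k)) (f : MvPolynomial σ k) :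
    (jetSub k σ m f).map (constantJet m I : _ →+* _) = Polynomial.C (Ideal.Quotient.mk I f) := by
  have : (Polynomial.mapAlgHom (constantJet m I)).comp (jetSub k σ m) =
      (Polynomial.CAlgHom (R := k)).comp (Ideal.Quotient.mkₐ k I) := by
    refine MvPolynomial.algHom_ext fun i => ?_
    simp only [AlgHom.comp_apply, jetSub_X, map_sum, map_mul, map_pow]
    rw [Finset.sum_eq_single 0]
    · simp [constantJet]
    · intro b _ hb
      simp [constantJet, hb]
    · simp
  exact DFunLike.congr_fun this f

theorem constantJet_coeff (I : Ideal (MvPolynomial σ k)) (f : MvPolynomial σ k) (l : ℕ) :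
    constantJet m I ((jetSub k σ m f).coeff l) = if l = 0 then Ideal.Quotient.mk I f else 0 := by
  rw [← Polynomial.coeff_C, ← map_constantJet_jetSub m I f, Polynomial.coeff_map]
  rfl

theorem coeff_zero_notMem_radical_jetIdeal {F : Set (MvPolynomial σ k)}
    (hF : (Ideal.span F).IsPrime) {d : MvPolynomial σ k} (hd : d ∉ Ideal.span F) :
    (jetSub k σ m d).coeff 0 ∉ (jetIdeal k σ m F).radical := by
  have hker : jetIdeal k σ m F ≤ RingHom.ker (constantJet m (Ideal.span F)) := by
    refine Ideal.span_le.mpr ?_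
    rintro _ ⟨f, hf, l, -, rfl⟩
    rw [SetLike.mem_coe, RingHom.mem_ker, constantJet_coeff,
      Ideal.Quotient.eq_zero_iff_mem.mpr (Ideal.subset_span hf), ite_self]
  intro hmem
  have h := (RingHom.ker_isPrime (constantJet m (Ideal.span F))).radical_le_iff.mpr hker hmem
  rw [RingHom.mem_ker, constantJet_coeff, if_pos rfl, Ideal.Quotient.eq_zero_iff_mem] at h
  exact hd h

theorem mem_of_sum_mul_pderiv_coeff_jetSub_mem [DecidableEq σ] [Fintype σ] {ι : Type*} [Fintype ι]
    [DecidableEq ι] (f : ι → MvPolynomial σ k) (hf : (Ideal.span (Set.range f)).IsPrime)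
    {d : MvPolynomial σ k} (hd : d ∉ Ideal.span (Set.range f)) (B : σ → ι → MvPolynomial σ k)
    (hB : ∀ i i', ∑ j, MvPolynomial.pderiv j (f i) * B j i' - (if i = i' then d else 0) ∈
      Ideal.span (Set.range f))
    (hP : (jetIdeal k σ m (Set.range f)).radical.IsPrime)
    (a : ι × Fin (m + 1) → MvPolynomial (σ × Fin (m + 1)) k)
    (ha : ∀ s, ∑ x, a x * MvPolynomial.pderiv s ((jetSub k σ m (f x.1)).coeff x.2) ∈
      (jetIdeal k σ m (Set.range f)).radical) (x : ι × Fin (m + 1)) :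
    a x ∈ (jetIdeal k σ m (Set.range f)).radical := by
  set P := (jetIdeal k σ m (Set.range f)).radical with hPdef
  let e : MvPolynomial σ k →+* MvPolynomial (σ × Fin (m + 1)) k :=
    Polynomial.constantCoeff.comp (jetSub k σ m).toRingHom
  have he (p) : (jetSub k σ m p).coeff 0 = e p := rfl
  have heI (p) (hp : p ∈ Ideal.span (Set.range f)) : e p ∈ P :=
    Ideal.le_radical (coeff_zero_mem_jetIdeal m hp)
  obtain ⟨i', l⟩ := x
  induction l using WellFoundedGT.induction generalizing i' with
  | ind l ih =>
  have h1 (j : σ) : ∑ i, a (i, l) * e (MvPolynomial.pderiv j (f i)) ∈ P := by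
    have h := ha (j, l)
    rw [Fintype.sum_prod_type_right] at h
    rw [← Finset.add_sum_erase _ _ (Finset.mem_univ l)] at h
    simp only [pderiv_coeff_jetSub, Polynomial.coeff_mul_X_pow'] at h
    simp only [le_refl, if_true, Nat.sub_self, he] at h
    refine (P.add_mem_iff_left (P.sum_mem fun l' hl' => P.sum_mem fun i _ => ?_)).mp h
    split_ifs with hll
    · exact P.mul_mem_right _ (ih l' (lt_of_le_of_ne hll (Finset.ne_of_mem_erase hl').symm) i)
    · rw [mul_zero]; exact P.zero_mem
  have h2 : ∑ j, (∑ i, a (i, l) * e (MvPolynomial.pderiv j (f i))) * e (B j i') ∈ P :=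
    P.sum_mem fun j _ => P.mul_mem_right _ (h1 j)
  have h3 : ∑ j, (∑ i, a (i, l) * e (MvPolynomial.pderiv j (f i))) * e (B j i') =
      a (i', l) * e d + ∑ i, a (i, l) * e (∑ j, MvPolynomial.pderiv j (f i) * B j i' -
        (if i = i' then d else 0)) := by
    simp only [map_sub, map_sum, map_mul, mul_sub, Finset.sum_sub_distrib, Finset.sum_mul,
      Finset.mul_sum]
    rw [Finset.sum_comm]
    simp [apply_ite e, mul_assoc]
  rw [h3, P.add_mem_iff_left (P.sum_mem fun i _ => P.mul_mem_left _ (heI _ (hB i i')))] at h2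
  exact (hP.mem_or_mem h2).resolve_right (coeff_zero_notMem_radical_jetIdeal m hf hd)

end Jets

universe u

theorem ringKrullDim_le_of_isIntegral_of_injective {R S : Type*} [CommRing R] [CommRing S]
    [Algebra R S] [Algebra.IsIntegral R S] [FaithfulSMul R S] :
    ringKrullDim R ≤ ringKrullDim S := by
  refine iSup_le fun l ↦ ?_
  obtain ⟨Q, hQ, hQl⟩ := (inferInstance : Nonempty (l.head.asIdeal.primesOver S))
  obtain ⟨L, hL, -⟩ := Ideal.exists_ltSeries_of_hasGoingUp l Q
  rw [← hL]
  exact Order.LTSeries.length_le_krullDim L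

theorem Algebra.trdeg_le_of_ringKrullDim_le {k A : Type u} [Field k] [CommRing A] [IsDomain A]
    [Algebra k A] [Algebra.FiniteType k A] {n : ℕ} (h : ringKrullDim A ≤ n) :
    Algebra.trdeg k A ≤ n := by
  obtain ⟨t, g, hg, hint⟩ := exists_integral_inj_algHom_of_fg k A
  algebraize [g.toRingHom]
  have : IsScalarTower k (MvPolynomial (Fin t) k) A := .of_algHom g
  have : FaithfulSMul (MvPolynomial (Fin t) k) A :=
    (faithfulSMul_iff_algebraMap_injective _ _).mpr hg
  have : Algebra.IsIntegral (MvPolynomial (Fin t) k) A := ⟨hint⟩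
  rw [← trdeg_add_eq k (MvPolynomial (Fin t) k) (A := A),
    trdeg_eq_zero (R := MvPolynomial (Fin t) k) (A := A), add_zero, MvPolynomial.trdeg_of_isDomain]
  have := (ringKrullDim_le_of_isIntegral_of_injective
    (R := MvPolynomial (Fin t) k) (S := A)).trans h
  rw [MvPolynomial.ringKrullDim_of_isNoetherianRing] at this
  simp at this
  simpa using by exact_mod_cast this

section GenericSmoothness

open MvPolynomial

variable {k σ K : Type*} [Field k] [Field K] [Algebra k K]

theorem MvPolynomial.aeval_inl_add_inr [Fintype σ] (x v : σ → K) (p : MvPolynomial σ k) :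
    aeval (fun j ↦ (TrivSqZeroExt.inl (x j) + TrivSqZeroExt.inr (v j) : TrivSqZeroExt K K)) p =
      TrivSqZeroExt.inl (aeval x p) +
        TrivSqZeroExt.inr (∑ j, aeval x (pderiv j p) * v j) := by
  classical
  induction p using MvPolynomial.induction_on with
  | C a =>
    simp [TrivSqZeroExt.algebraMap_eq_inl']
  | add p q hp hq =>
    simp only [map_add, hp, hq, add_mul, Finset.sum_add_distrib, TrivSqZeroExt.inl_add,
      TrivSqZeroExt.inr_add]
    abel
  | mul_X p i hp =>
    rw [map_mul, hp, aeval_X]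
    ext
    · simp
    · simp [pderiv_X, Pi.single_apply, mul_add, Finset.sum_add_distrib, Finset.mul_sum,
        mul_comm, mul_left_comm, apply_ite, add_comm]

theorem eq_zero_of_isSeparable_of_sum_mul_eq_zero [Fintype σ] {I : Ideal (MvPolynomial σ k)}
    [I.IsPrime] [Algebra (MvPolynomial σ k ⧸ I) K] [IsFractionRing (MvPolynomial σ k ⧸ I) K]
    [IsScalarTower k (MvPolynomial σ k ⧸ I) K] {x : σ → K}
    (hx : ∀ j, x j = algebraMap (MvPolynomial σ k ⧸ I) K (Ideal.Quotient.mk I (X j)))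
    (s : Set K) [Algebra.IsSeparable (IntermediateField.adjoin k s) K] (v : σ → K)
    (hI : ∀ p ∈ I, ∑ j, aeval x (pderiv j p) * v j = 0)
    (hs : ∀ y ∈ s, ∃ p q : MvPolynomial σ k, aeval x q ≠ 0 ∧ aeval x p = y * aeval x q ∧
      ∑ j, (aeval x (pderiv j p) - y * aeval x (pderiv j q)) * v j = 0) : v = 0 := by
  let A := MvPolynomial σ k ⧸ I
  let L := IntermediateField.adjoin k s
  have hxp (p : MvPolynomial σ k) : aeval x p = algebraMap A K (Ideal.Quotient.mk I p) := by
    have : aeval x = (IsScalarTower.toAlgHom k A K).comp (Ideal.Quotient.mkₐ k I) := by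
      ext j
      simp [hx, A]
    rw [this]
    rfl
  let ψ₀ : MvPolynomial σ k →ₐ[k] TrivSqZeroExt K K :=
    aeval fun j ↦ TrivSqZeroExt.inl (x j) + TrivSqZeroExt.inr (v j)
  have hψ₀ (p) : ψ₀ p = TrivSqZeroExt.inl (aeval x p) +
      TrivSqZeroExt.inr (∑ j, aeval x (pderiv j p) * v j) := aeval_inl_add_inr x v p
  let ψ₁ : A →ₐ[k] TrivSqZeroExt K K := Ideal.Quotient.liftₐ I ψ₀ fun p hp ↦ by
    rw [hψ₀, hI p hp, hxp, Ideal.Quotient.eq_zero_iff_mem.mpr hp]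
    simp
  have hψ₁ (p) : ψ₁ (Ideal.Quotient.mk I p) = ψ₀ p := rfl
  have hfst₁ (a : A) : (ψ₁ a).fst = algebraMap A K a := by
    obtain ⟨p, rfl⟩ := Ideal.Quotient.mk_surjective a
    rw [hψ₁, hψ₀, ← hxp]
    simp
  let ψ : K →ₐ[k] TrivSqZeroExt K K :=
    IsLocalization.liftAlgHom (M := nonZeroDivisors A) (f := ψ₁) fun y ↦ by
      rw [TrivSqZeroExt.isUnit_iff_isUnit_fst, hfst₁, isUnit_iff_ne_zero]
      exact IsFractionRing.to_map_ne_zero_of_mem_nonZeroDivisors y.2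
  have hψ (a : A) : ψ (algebraMap A K a) = ψ₁ a := IsLocalization.lift_eq _ _
  have hfst (y : K) : (ψ y).fst = y := by
    have : (TrivSqZeroExt.fstHom k K K).comp ψ = AlgHom.id k K :=
      IsLocalization.algHom_ext (nonZeroDivisors A) <|
        AlgHom.ext fun a ↦ (congrArg _ (hψ a)).trans (hfst₁ a)
    exact DFunLike.congr_fun this y
  have hψs (y) (hy : y ∈ s) : ψ y = TrivSqZeroExt.inl y := by
    obtain ⟨p, q, hq, hpq, h⟩ := hs y hy
    have h1 : ψ y * ψ (aeval x q) = ψ (aeval x p) := by rw [hpq, map_mul]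
    rw [hxp, hxp, hψ, hψ, hψ₁, hψ₁, hψ₀, hψ₀, TrivSqZeroExt.ext_iff] at h1
    ext
    · simp [hfst]
    · have h2 := h1.2
      simp [hfst] at h2
      simp only [sub_mul, Finset.sum_sub_distrib, mul_assoc, ← Finset.mul_sum] at h
      have h3 : (aeval x q) * (ψ y).snd = 0 := by linear_combination h2 + h
      simpa [hq] using h3
  have hψL (y : L) : ψ (algebraMap L K y) = algebraMap L (TrivSqZeroExt K K) y := by
    obtain ⟨y, hy⟩ := y
    change ψ y = TrivSqZeroExt.inl y
    induction hy using IntermediateField.adjoin_induction with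
    | mem y hy => exact hψs y hy
    | algebraMap y => rw [AlgHom.commutes]; rfl
    | add a b _ _ ha hb => rw [map_add, ha, hb, TrivSqZeroExt.inl_add]
    | inv a _ ha =>
      rcases eq_or_ne a 0 with rfl | h0
      · rw [inv_zero, map_zero, TrivSqZeroExt.inl_zero]
      · have h1 : ψ a⁻¹ * ψ a = 1 := by rw [← map_mul, inv_mul_cancel₀ h0, map_one]
        calc ψ a⁻¹ = ψ a⁻¹ * TrivSqZeroExt.inl (a * a⁻¹) := by
              rw [mul_inv_cancel₀ h0, TrivSqZeroExt.inl_one, mul_one]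
          _ = TrivSqZeroExt.inl a⁻¹ := by
              rw [TrivSqZeroExt.inl_mul, ← ha, ← mul_assoc, h1, one_mul]
    | mul a b _ _ ha hb => rw [map_mul, ha, hb, TrivSqZeroExt.inl_mul]
  let ψL : K →ₐ[L] TrivSqZeroExt K K := { ψ with commutes' := hψL }
  have : Algebra.FormallyUnramified L K := Algebra.FormallyUnramified.of_isSeparable L K
  have key : ψL = TrivSqZeroExt.inlAlgHom L K K :=
    Algebra.FormallyUnramified.ext' (TrivSqZeroExt.fstHom K K K : TrivSqZeroExt K K →+* K)
      ⟨2, TrivSqZeroExt.kerIdeal_sq K K⟩ _ _ fun y ↦ hfst y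
  ext j
  have h1 : ψ (x j) = TrivSqZeroExt.inl (x j) := DFunLike.congr_fun key (x j)
  have h2 : ψ (x j) = TrivSqZeroExt.inl (x j) + TrivSqZeroExt.inr (v j) := by
    rw [hx, hψ, hψ₁, ← hx]
    exact aeval_X _ _
  simpa using congrArg TrivSqZeroExt.snd (h2.symm.trans h1)

theorem exists_sum_pderiv_mul_sub_mem_span_of_ringKrullDim_le {k : Type u} [Field k]
    [PerfectField k] {σ ι : Type} [Fintype σ] [Fintype ι] [DecidableEq ι]
    (f : ι → MvPolynomial σ k) (hf : (Ideal.span (Set.range f)).IsPrime) {n : ℕ}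
    (hn : ringKrullDim (MvPolynomial σ k ⧸ Ideal.span (Set.range f)) ≤ n)
    (hcard : Fintype.card ι + n ≤ Fintype.card σ) :
    ∃ d ∉ Ideal.span (Set.range f), ∃ B : σ → ι → MvPolynomial σ k, ∀ i i',
      ∑ j, pderiv j (f i) * B j i' - (if i = i' then d else 0) ∈ Ideal.span (Set.range f) := by
  set I := Ideal.span (Set.range f) with hIdef
  let A := MvPolynomial σ k ⧸ I
  let K := FractionRing A
  have : Algebra.EssFiniteType A K := Algebra.EssFiniteType.of_isLocalization K (nonZeroDivisors A)
  have : Algebra.EssFiniteType k K := Algebra.EssFiniteType.comp k A K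
  obtain ⟨s, hs, hsep⟩ := exists_isTranscendenceBasis_and_isSeparable_of_perfectField k K
  have hsn : s.card ≤ n := by
    have h1 : Algebra.trdeg k A ≤ n := Algebra.trdeg_le_of_ringKrullDim_le hn
    have : Algebra.IsAlgebraic A K := IsLocalization.isAlgebraic K (nonZeroDivisors A)
    have h2 : Algebra.trdeg k A + Algebra.trdeg A K = Algebra.trdeg k K := trdeg_add_eq k A
    rw [trdeg_eq_zero (R := A) (A := K), add_zero, ← hs.cardinalMk_eq_trdeg] at h2
    rw [h2, Cardinal.mk_coe_finset] at h1
    exact_mod_cast h1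
  let x : σ → K := fun j ↦ algebraMap A K (Ideal.Quotient.mk I (X j))
  have hxp (p : MvPolynomial σ k) : aeval x p = algebraMap A K (Ideal.Quotient.mk I p) := by
    have : aeval x = (IsScalarTower.toAlgHom k A K).comp (Ideal.Quotient.mkₐ k I) := by
      ext j
      simp [x, A]
    rw [this]
    rfl
  have hxI (p : MvPolynomial σ k) : aeval x p = 0 ↔ p ∈ I := by
    rw [hxp, FaithfulSMul.algebraMap_eq_zero_iff, Ideal.Quotient.eq_zero_iff_mem]
  have hpq (y : K) : ∃ p q : MvPolynomial σ k, aeval x q ≠ 0 ∧ aeval x p = y * aeval x q := by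
    obtain ⟨a, b, hb, rfl⟩ := IsFractionRing.div_surjective (A := A) y
    obtain ⟨p, rfl⟩ := Ideal.Quotient.mk_surjective a
    obtain ⟨q, rfl⟩ := Ideal.Quotient.mk_surjective b
    have hq : aeval x q ≠ 0 := by
      rw [hxp]
      exact IsFractionRing.to_map_ne_zero_of_mem_nonZeroDivisors hb
    refine ⟨p, q, hq, ?_⟩
    rw [← hxp, ← hxp, div_mul_cancel₀ _ hq]
  choose p q hq hp using hpq
  let J : Matrix ι σ K := .of fun i j ↦ aeval x (pderiv j (f i))
  let U : Matrix s σ K := .of fun y j ↦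
    aeval x (pderiv j (p y)) - y * aeval x (pderiv j (q y))
  let T : (σ → K) →ₗ[K] (ι → K) × (s → K) := J.mulVecLin.prod U.mulVecLin
  have hT : Function.Injective T := by
    refine (injective_iff_map_eq_zero T).mpr fun v hv ↦ ?_
    have hJ (i) : ∑ j, aeval x (pderiv j (f i)) * v j = 0 :=
      congrFun (congrArg Prod.fst hv) i
    have hU (y : s) : ∑ j, (aeval x (pderiv j (p y)) - y * aeval x (pderiv j (q y))) * v j = 0 :=
      congrFun (congrArg Prod.snd hv) y
    refine eq_zero_of_isSeparable_of_sum_mul_eq_zero (I := I) (x := x) (fun _ ↦ rfl) (s : Set K) v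
      (fun g hg ↦ ?_) fun y hy ↦ ⟨p y, q y, hq y, hp y, hU ⟨y, hy⟩⟩
    induction hg using Submodule.span_induction with
    | mem g hg =>
      obtain ⟨i, rfl⟩ := hg
      exact hJ i
    | zero => simp
    | add g h _ _ hg hh =>
      simp only [map_add, add_mul, Finset.sum_add_distrib, hg, hh, add_zero]
    | smul a g hg' hg =>
      have hg0 : aeval x g = 0 := (hxI g).mpr hg'
      simp only [smul_eq_mul, Derivation.leibniz, map_add, map_mul, hg0, zero_mul, add_zero,
        mul_assoc, ← Finset.mul_sum, hg, mul_zero]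
  have hT' : Function.Surjective T := by
    refine (LinearMap.injective_iff_surjective_of_finrank_eq_finrank ?_).mp hT
    refine (LinearMap.finrank_le_finrank_of_injective hT).antisymm ?_
    simp only [Module.finrank_prod, Module.finrank_fintype_fun_eq_card, Fintype.card_coe]
    omega
  have hb (i' : ι) : ∃ b : σ → K, ∀ i,
      ∑ j, aeval x (pderiv j (f i)) * b j = if i = i' then 1 else 0 := by
    obtain ⟨b, hb⟩ := hT' (fun i ↦ if i = i' then 1 else 0, 0)
    exact ⟨b, fun i ↦ congrFun (congrArg Prod.fst hb) i⟩
  choose b hb using hb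
  obtain ⟨⟨d, hd⟩, h⟩ := IsLocalization.exist_integer_multiples_of_finite (nonZeroDivisors A)
    fun z : σ × ι ↦ b z.2 z.1
  choose B' hB' using h
  obtain ⟨d, rfl⟩ := Ideal.Quotient.mk_surjective d
  choose B hB using fun z ↦ Ideal.Quotient.mk_surjective (B' z)
  have hB'' (z : σ × ι) : aeval x (B z) = aeval x d * b z.2 z.1 := by
    rw [hxp, hB, hB', hxp, Algebra.smul_def]
  refine ⟨d, fun h ↦ nonZeroDivisors.ne_zero hd (Ideal.Quotient.eq_zero_iff_mem.mpr h),
    fun j i ↦ B (j, i), fun i i' ↦ (hxI _).mp ?_⟩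
  simp only [map_sub, map_sum, map_mul, hB'', mul_left_comm _ (aeval x d), ← Finset.mul_sum, hb]
  split_ifs <;> simp

end GenericSmoothness

/- STATEMENT 5: If `X` is an l.c.i. variety (cut out in `𝔸^N` by `N - n` equations) over an
algebraically closed field and the `m`-th jet scheme `X_m` is irreducible for some `m ≥ 1`,
then `X_m` is reduced, i.e. its defining ideal is a radical ideal. -/
theorem stmt5 (k : Type*) [Field k] [IsAlgClosed k] (N n : ℕ) (hn : n ≤ N)
    (F : Fin (N - n) → MvPolynomial (Fin N) k)
    (hdom : IsDomain (MvPolynomial (Fin N) k ⧸ Ideal.span (Set.range F)))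
    (hdim : ringKrullDim (MvPolynomial (Fin N) k ⧸ Ideal.span (Set.range F)) = n)
    (m : ℕ) (hm : 1 ≤ m)
    (hirr : (jetIdeal k (Fin N) m (Set.range F)).radical.IsPrime) :
    (jetIdeal k (Fin N) m (Set.range F)).IsRadical := by
  have hf := (Ideal.Quotient.isDomain_iff_prime _).mp hdom
  obtain ⟨d, hd, B, hB⟩ := exists_sum_pderiv_mul_sub_mem_span_of_ringKrullDim_le F hf hdim.le
    (by simpa using (Nat.sub_add_cancel hn).le)
  let g (x : Fin (N - n) × Fin (m + 1)) : MvPolynomial (Fin N × Fin (m + 1)) k :=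
    (jetSub k (Fin N) m (F x.1)).coeff x.2
  let P := (jetIdeal k (Fin N) m (Set.range F)).radical
  have hJ : jetIdeal k (Fin N) m (Set.range F) = Ideal.span (Set.range g) := jetIdeal_range m F
  have hgP (x) : g x ∈ P :=
    Ideal.le_radical (hJ ▸ Ideal.subset_span ⟨x, rfl⟩)
  have hjac (a : Fin (N - n) × Fin (m + 1) → MvPolynomial (Fin N × Fin (m + 1)) k)
      (ha : ∀ s, ∑ x, a x * MvPolynomial.pderiv s (g x) ∈ P) (x) : a x ∈ P :=
    mem_of_sum_mul_pderiv_coeff_jetSub_mem m F hf hd B hB hirr a ha x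
  have hle : (Fintype.card (Fin (N - n) × Fin (m + 1)) : ℕ∞) ≤ P.height :=
    Ideal.card_le_height_of_jacobian MvPolynomial.pderiv g hgP hjac
  have hmin : P ∈ (Ideal.span (Set.range g)).minimalPrimes :=
    ⟨⟨hirr, hJ ▸ Ideal.le_radical⟩, fun Q hQ _ ↦ (hQ.1.isRadical.radical_le_iff).mpr (hJ ▸ hQ.2)⟩
  have hge : P.height ≤ Fintype.card (Fin (N - n) × Fin (m + 1)) := by
    refine (Ideal.height_le_card_of_mem_minimalPrimes_span (Set.finite_range g) hmin).trans ?_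
    rw [← Set.image_univ, ← Nat.card_eq_fintype_card, ← Set.ncard_univ]
    exact Nat.cast_le.mpr (Set.ncard_image_le Set.finite_univ)
  let V := Submodule.span k (Set.range g)
  have hV : Ideal.span (V : Set (MvPolynomial (Fin N × Fin (m + 1)) k)) =
      Ideal.span (Set.range g) := Submodule.span_span_of_tower k _ _
  have : FiniteDimensional k V := FiniteDimensional.span_of_finite k (Set.finite_range g)
  have : Infinite k := IsAlgClosed.instInfinite
  rw [hJ, ← hV]
  refine IsRegularRing.isRadical_span_of_isPrime_radical V hirr (by rw [hV, ← hJ]) ?_ fun x hx ↦ ?_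
  · exact (Nat.cast_le.mpr (finrank_range_le_card g)).trans hle
  · rw [hV]
    exact Ideal.exists_mul_mem_span_of_jacobian MvPolynomial.pderiv g hgP hjac hge hx
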